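/- Let i be a nonnegative integer and let α, β, ε be complex numbers. Assume that (β)_{m+n} is nonzero for all nonnegative integers m, n, that no argument of Γ appearing on the right-hand side below is a nonpositive integer, and that the double series defining the Kampé de Fériet function converges absolutely. Then F^{0:2;2}_{1:0;0}[— : α, ε ; β−ε, β+ε−α−i−1 ; β : — ; — ; −1, 1/2] = (2^{β+ε−α−i−2} · Γ(1−ε) · Γ(β)) / (Γ(1−ε+i) · Γ(β+ε−i−1)) · Σ_{r=0}^{i} (−1)^r · C(i,r) · Γ((β+ε−i+r−1)/2) / Γ((β−ε−i+r+1)/2). -/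

import Mathlib

open Complex

noncomputable section

/-- Pochhammer symbol `(a)_n = a (a+1) ⋯ (a+n-1)`. -/
def poch (a : ℂ) (n : ℕ) : ℂ := ∏ k ∈ Finset.range n, (a + k)

/-- `z` is not a nonpositive integer. -/
def notNonposInt (z : ℂ) : Prop := ∀ n : ℕ, z ≠ -(n : ℂ)

/-- Term of the Kampé de Fériet double series `F^{0:2;2}_{1:0;0}`. -/
def kdfTerm (a₁ a₂ b₁ b₂ β x y : ℂ) (p : ℕ × ℕ) : ℂ :=
  poch a₁ p.1 * poch a₂ p.1 * poch b₁ p.2 * poch b₂ p.2 /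
    poch β (p.1 + p.2) * x ^ p.1 * y ^ p.2 /
    ((p.1.factorial : ℂ) * (p.2.factorial : ℂ))

open Finset.HasAntidiagonal (antidiagonal)

/-- The coefficient `(a)_n / n!` of `(1 - x)^(-a)`. -/
def negBinom (a : ℂ) (n : ℕ) : ℂ := poch a n / (n.factorial : ℂ)

theorem poch_zero (a : ℂ) : poch a 0 = 1 := by simp [poch]

theorem poch_succ (a : ℂ) (n : ℕ) : poch a (n + 1) = poch a n * (a + n) := by
  simp [poch, Finset.prod_range_succ]

theorem poch_add (a : ℂ) (m n : ℕ) : poch a (m + n) = poch a m * poch (a + m) n := by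
  simp only [poch, Finset.prod_range_add]
  congr 1
  exact Finset.prod_congr rfl fun k _ => by push_cast; ring

theorem poch_reflect (a : ℂ) (n : ℕ) : poch a n = (-1) ^ n * poch (1 - a - n) n := by
  have h0 : ((-1 : ℂ)) ^ n = ∏ _k ∈ Finset.range n, (-1 : ℂ) := by simp
  rw [poch, poch, ← Finset.prod_range_reflect, h0, ← Finset.prod_mul_distrib]
  refine Finset.prod_congr rfl fun k hk => ?_
  have hk' : k + 1 ≤ n := by simpa [Nat.succ_le_iff] using hk
  have h : ((n - 1 - k : ℕ) : ℂ) = n - 1 - k := by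
    rw [Nat.sub_sub, Nat.cast_sub (by lia)]; push_cast; ring
  rw [h]
  ring

theorem negBinom_zero (a : ℂ) : negBinom a 0 = 1 := by simp [negBinom, poch_zero]

theorem succ_mul_negBinom_succ (a : ℂ) (n : ℕ) :
    ((n : ℂ) + 1) * negBinom a (n + 1) = (a + n) * negBinom a n := by
  have h1 : (n.factorial : ℂ) ≠ 0 := by exact_mod_cast n.factorial_ne_zero
  have h2 : (n : ℂ) + 1 ≠ 0 := by exact_mod_cast n.succ_ne_zero
  rw [negBinom, negBinom, poch_succ, Nat.factorial_succ]
  push_cast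
  field_simp

/-- The Chu–Vandermonde identity. -/
theorem sum_negBinom_mul_negBinom (a b : ℂ) (n : ℕ) :
    ∑ p ∈ antidiagonal n, negBinom a p.1 * negBinom b p.2 = negBinom (a + b) n := by
  induction n with
  | zero => simp [negBinom_zero]
  | succ n ih =>
    have h2 : (n : ℂ) + 1 ≠ 0 := by exact_mod_cast n.succ_ne_zero
    apply mul_left_cancel₀ h2
    rw [succ_mul_negBinom_succ, ← ih, Finset.Nat.sum_antidiagonal_eq_sum_range_succ_mk,
      Finset.Nat.sum_antidiagonal_eq_sum_range_succ_mk, Finset.sum_range_succ, mul_add,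
      Finset.mul_sum, Finset.mul_sum]
    have key := Finset.sum_range_sub
      (fun k => -(k : ℂ) * (negBinom a k * negBinom b (n + 1 - k))) (n + 1)
    have hsum : ∑ k ∈ Finset.range (n + 1),
          (((n : ℂ) + 1) * (negBinom a k * negBinom b (n + 1 - k))
            - (a + b + n) * (negBinom a k * negBinom b (n - k)))
        = -((n + 1 : ℕ) : ℂ) * (negBinom a (n + 1) * negBinom b (n + 1 - (n + 1)))
          - -((0 : ℕ) : ℂ) * (negBinom a 0 * negBinom b (n + 1 - 0)) := by
      rw [← key]
      refine Finset.sum_congr rfl fun k hk => ?_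
      obtain ⟨j, rfl⟩ : ∃ j, n = k + j := ⟨n - k, by simp at hk; lia⟩
      have e1 : k + j + 1 - k = j + 1 := by lia
      have e2 : k + j - k = j := by lia
      have e3 : k + j + 1 - (k + 1) = j := by lia
      rw [e1, e2, e3]
      have ha := succ_mul_negBinom_succ a k
      have hb := succ_mul_negBinom_succ b j
      push_cast
      linear_combination negBinom a k * hb + negBinom b j * ha
    rw [Finset.sum_sub_distrib] at hsum
    simp only [Nat.sub_self] at hsum ⊢
    push_cast at hsum
    linear_combination hsum

/-- The Pfaff–Saalschütz identity, as the coefficient form of Euler's transformation. -/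
theorem sum_hypergeometric_mul_negBinom (a b c : ℂ) (hc : ∀ n, poch c n ≠ 0) (n : ℕ) :
    ∑ p ∈ antidiagonal n,
      (negBinom a p.1 * poch b p.1 / poch c p.1) * negBinom (c - a - b) p.2 =
      negBinom (c - a) n * poch (c - b) n / poch c n := by
  have hc' : ∀ n : ℕ, c + n ≠ 0 := fun n h => hc (n + 1) (by rw [poch_succ, h, mul_zero])
  have hu : ∀ a b : ℂ, ∀ n : ℕ, ((n : ℂ) + 1) * (c + n) *
      (negBinom a (n + 1) * poch b (n + 1) / poch c (n + 1)) =
      (a + n) * (b + n) * (negBinom a n * poch b n / poch c n) := by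
    intro a b n
    have h := succ_mul_negBinom_succ a n
    have h1 := hc n
    have h2 := hc' n
    rw [poch_succ, poch_succ]
    field_simp
    linear_combination poch b n * (b + n) * h
  induction n with
  | zero => simp [negBinom_zero, poch_zero]
  | succ n ih =>
    have h2 : (n : ℂ) + 1 ≠ 0 := by exact_mod_cast n.succ_ne_zero
    apply mul_left_cancel₀ (mul_ne_zero h2 (hc' n))
    rw [hu, ← ih, Finset.Nat.sum_antidiagonal_eq_sum_range_succ_mk,
      Finset.Nat.sum_antidiagonal_eq_sum_range_succ_mk, Finset.sum_range_succ, mul_add,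
      Finset.mul_sum, Finset.mul_sum]
    set u : ℕ → ℂ := fun n => negBinom a n * poch b n / poch c n with hudef
    set v : ℕ → ℂ := negBinom (c - a - b) with hvdef
    have hu' : ∀ k : ℕ, ((k : ℂ) + 1) * (c + k) * u (k + 1) = (a + k) * (b + k) * u k := hu a b
    have key := Finset.sum_range_sub
      (fun k => -(k : ℂ) * (c + k - 1) * (u k * v (n + 1 - k))) (n + 1)
    have hsum : ∑ k ∈ Finset.range (n + 1),
          (((n : ℂ) + 1) * (c + n) * (u k * v (n + 1 - k))
            - (c - a + n) * (c - b + n) * (u k * v (n - k)))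
        = -((n + 1 : ℕ) : ℂ) * (c + (n + 1 : ℕ) - 1) * (u (n + 1) * v (n + 1 - (n + 1)))
          - -((0 : ℕ) : ℂ) * (c + (0 : ℕ) - 1) * (u 0 * v (n + 1 - 0)) := by
      rw [← key]
      refine Finset.sum_congr rfl fun k hk => ?_
      obtain ⟨j, rfl⟩ : ∃ j, n = k + j := ⟨n - k, by simp at hk; lia⟩
      have e1 : k + j + 1 - k = j + 1 := by lia
      have e2 : k + j - k = j := by lia
      have e3 : k + j + 1 - (k + 1) = j := by lia
      rw [e1, e2, e3]
      have ha := hu' k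
      have hb : ((j : ℂ) + 1) * v (j + 1) = (c - a - b + j) * v j :=
        succ_mul_negBinom_succ (c - a - b) j
      have hj : (j : ℂ) + 1 ≠ 0 := by exact_mod_cast j.succ_ne_zero
      have hv : v (j + 1) = (c - a - b + j) * v j / (j + 1) := by
        rw [← hb]; field_simp
      rw [hv]
      push_cast
      field_simp
      linear_combination (j + 1) * v j * ha
    rw [Finset.sum_sub_distrib] at hsum
    simp only [Nat.sub_self] at hsum ⊢
    push_cast at hsum
    linear_combination hsum

/-- Alternating form of the Chu–Vandermonde identity with a shifted lower argument. -/
theorem sum_neg_one_pow_mul_negBinom (x b : ℂ) (r : ℕ) :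
    ∑ p ∈ antidiagonal r, (-1) ^ p.1 * negBinom x p.1 * negBinom (b + p.1) p.2 =
      negBinom (b - x) r := by
  have h1 : negBinom (b - x) r = (-1) ^ r * negBinom (x + (1 - b - r)) r := by
    rw [negBinom, negBinom, poch_reflect (b - x) r, ← mul_div_assoc]
    congr 3
    ring
  rw [h1, ← sum_negBinom_mul_negBinom, Finset.mul_sum]
  refine Finset.sum_congr rfl fun p hp => ?_
  obtain ⟨t, k⟩ := p
  rw [Finset.HasAntidiagonal.mem_antidiagonal] at hp
  dsimp only at hp ⊢
  subst hp
  have h2 : negBinom (b + t) k = (-1) ^ k * negBinom (1 - b - (t + k : ℕ)) k := by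
    rw [negBinom, negBinom, poch_reflect (b + t) k, ← mul_div_assoc]
    congr 3
    push_cast
    ring
  rw [h2, pow_add]
  ring

theorem choose_mul_negBinom (a : ℂ) (l t : ℕ) :
    ((l + t).choose l : ℂ) * negBinom a (l + t) = negBinom a l * negBinom (a + l) t := by
  have h1 : (l.factorial : ℂ) ≠ 0 := by exact_mod_cast l.factorial_ne_zero
  have h2 : (t.factorial : ℂ) ≠ 0 := by exact_mod_cast t.factorial_ne_zero
  have h3 : ((l + t).factorial : ℂ) ≠ 0 := by exact_mod_cast (l + t).factorial_ne_zero
  have h4 : ((l + t).choose l : ℂ) * l.factorial * t.factorial = (l + t).factorial := by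
    rw [Nat.choose_symm_add]
    exact_mod_cast Nat.add_choose_mul_factorial_mul_factorial l t
  rw [negBinom, negBinom, negBinom, poch_add]
  field_simp
  rw [← h4]
  ring

theorem sum_alternating_choose_succ (f : ℕ → ℂ) (i : ℕ) :
    ∑ r ∈ Finset.range (i + 2), (-1 : ℂ) ^ r * ((i + 1).choose r : ℂ) * f r =
      ∑ r ∈ Finset.range (i + 1), (-1 : ℂ) ^ r * (i.choose r : ℂ) * f r -
      ∑ r ∈ Finset.range (i + 1), (-1 : ℂ) ^ r * (i.choose r : ℂ) * f (r + 1) := by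
  have h : ∑ r ∈ Finset.range (i + 1), (-1 : ℂ) ^ r * (i.choose r : ℂ) * f r =
      ∑ r ∈ Finset.range (i + 2), (-1 : ℂ) ^ r * (i.choose r : ℂ) * f r := by
    rw [Finset.sum_range_succ _ (i + 1)]
    simp
  rw [h, Finset.sum_range_succ', Finset.sum_range_succ' _ (i + 1)]
  simp only [Nat.choose_succ_succ, Nat.cast_add, pow_succ]
  rw [add_sub_right_comm, ← Finset.sum_sub_distrib]
  congr 1
  · exact Finset.sum_congr rfl fun r _ => by ring
  · simp

/-- Moments `u^m (1 - u)^n` of a beta distribution expanded in powers of `1 - u`. -/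
theorem sum_choose_mul_poch_div_poch (ε β : ℂ) (hβ : ∀ n, poch β n ≠ 0) (m n : ℕ) :
    ∑ l ∈ Finset.range (m + 1),
      (-1 : ℂ) ^ l * (m.choose l : ℂ) * (poch (β - ε) (l + n) / poch β (l + n)) =
      poch ε m * poch (β - ε) n / poch β (m + n) := by
  induction m generalizing n with
  | zero => simp [poch_zero]
  | succ m ih =>
    rw [sum_alternating_choose_succ (fun l => poch (β - ε) (l + n) / poch β (l + n)), ih n]
    have h := ih (n + 1)
    simp only [add_right_comm _ 1 n, add_assoc _ n 1] at h ⊢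
    rw [← add_assoc] at h
    simp only [← add_assoc] at h ⊢
    rw [h]
    have h1 := hβ (m + n)
    have h2 : β + (m + n : ℕ) ≠ 0 := fun h => hβ (m + n + 1) (by rw [poch_succ, h, mul_zero])
    rw [poch_succ, poch_succ, poch_succ]
    push_cast at h2 ⊢
    field_simp
    ring

theorem sum_antidiagonal_assoc (f : ℕ → ℕ → ℕ → ℂ) (N : ℕ) :
    ∑ p ∈ antidiagonal N, ∑ q ∈ antidiagonal p.1, f q.1 q.2 p.2 =
      ∑ p ∈ antidiagonal N, ∑ q ∈ antidiagonal p.2, f p.1 q.1 q.2 := by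
  rw [Finset.sum_sigma', Finset.sum_sigma']
  refine Finset.sum_nbij' (fun x => ⟨(x.2.1, x.2.2 + x.1.2), (x.2.2, x.1.2)⟩)
    (fun x => ⟨(x.1.1 + x.2.1, x.2.2), (x.1.1, x.2.1)⟩) ?_ ?_ ?_ ?_ ?_
  · rintro ⟨⟨a, b⟩, ⟨c, d⟩⟩ h
    simp only [Finset.mem_sigma, Finset.HasAntidiagonal.mem_antidiagonal] at h ⊢
    lia
  · rintro ⟨⟨a, b⟩, ⟨c, d⟩⟩ h
    simp only [Finset.mem_sigma, Finset.HasAntidiagonal.mem_antidiagonal] at h ⊢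
    lia
  · rintro ⟨⟨a, b⟩, ⟨c, d⟩⟩ h
    simp only [Finset.mem_sigma, Finset.HasAntidiagonal.mem_antidiagonal] at h ⊢
    rw [h.2]
  · rintro ⟨⟨a, b⟩, ⟨c, d⟩⟩ h
    simp only [Finset.mem_sigma, Finset.HasAntidiagonal.mem_antidiagonal] at h ⊢
    rw [h.2]
  · rintro ⟨⟨a, b⟩, ⟨c, d⟩⟩ _
    rfl

/-- Coefficient form of `(1 + (1 - u) x / (1 - x))^(-a) = (1 - x)^a (1 - u x)^(-a)`, with `u^l`
replaced by `M l`. -/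
theorem sum_negBinom_mul_alternating_sum (a : ℂ) (M : ℕ → ℂ) (j : ℕ) :
    ∑ q ∈ antidiagonal j, (-1) ^ q.1 * negBinom a q.1 * negBinom q.1 q.2 *
        ∑ l ∈ Finset.range (q.1 + 1), (-1 : ℂ) ^ l * (q.1.choose l : ℂ) * M l =
      ∑ q ∈ antidiagonal j, negBinom a q.1 * negBinom (-a) q.2 * M q.1 := by
  have h1 : ∀ q ∈ antidiagonal j, (-1) ^ q.1 * negBinom a q.1 * negBinom q.1 q.2 *
        ∑ l ∈ Finset.range (q.1 + 1), (-1 : ℂ) ^ l * (q.1.choose l : ℂ) * M l =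
      ∑ s ∈ antidiagonal q.1, negBinom a s.1 * M s.1 *
        ((-1) ^ s.2 * negBinom (a + s.1) s.2 * negBinom ((s.1 : ℂ) + s.2) q.2) := by
    intro q _
    rw [← Finset.Nat.sum_antidiagonal_eq_sum_range_succ_mk
      (fun s => (-1 : ℂ) ^ s.1 * (q.1.choose s.1 : ℂ) * M s.1), Finset.mul_sum]
    refine Finset.sum_congr rfl fun s hs => ?_
    rw [Finset.HasAntidiagonal.mem_antidiagonal] at hs
    rw [← hs]
    have h := choose_mul_negBinom a s.1 s.2
    have h2 : (-1 : ℂ) ^ s.1 * (-1) ^ s.1 = 1 := by rw [← mul_pow]; simp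
    push_cast
    rw [pow_add]
    linear_combination (-1 : ℂ) ^ s.1 * (-1) ^ s.1 * (-1) ^ s.2 * negBinom (s.1 + s.2) q.2 *
      M s.1 * h + negBinom a s.1 * negBinom (a + s.1) s.2 * (-1) ^ s.2 *
      negBinom (s.1 + s.2) q.2 * M s.1 * h2
  rw [Finset.sum_congr rfl h1, sum_antidiagonal_assoc (fun l t k => negBinom a l * M l *
        ((-1) ^ t * negBinom (a + l) t * negBinom ((l : ℂ) + t) k))]
  refine Finset.sum_congr rfl fun q _ => ?_
  rw [← Finset.mul_sum, sum_neg_one_pow_mul_negBinom]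
  rw [show (q.1 : ℂ) - (a + q.1) = -a by ring]
  ring

theorem sum_antidiagonal_kdf_coeff (α β γ ε : ℂ) (hβ : ∀ n, poch β n ≠ 0) (N : ℕ) :
    ∑ p ∈ antidiagonal N, ∑ q ∈ antidiagonal p.1,
      (-1) ^ q.1 * negBinom α q.1 * negBinom q.1 q.2 * negBinom (γ - α) p.2 *
        (poch ε q.1 * poch (β - ε) p.2 / poch β (q.1 + p.2)) =
      ∑ p ∈ antidiagonal N, negBinom (-α) p.1 *
        (negBinom γ p.2 * poch (β - ε) p.2 / poch β p.2) := by
  have h1 : ∀ p ∈ antidiagonal N, ∑ q ∈ antidiagonal p.1,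
      (-1) ^ q.1 * negBinom α q.1 * negBinom q.1 q.2 * negBinom (γ - α) p.2 *
        (poch ε q.1 * poch (β - ε) p.2 / poch β (q.1 + p.2)) =
      ∑ q ∈ antidiagonal p.1, negBinom (-α) q.1 * (negBinom α q.2 * negBinom (γ - α) p.2 *
        (poch (β - ε) (q.2 + p.2) / poch β (q.2 + p.2))) := by
    intro p _
    have h := sum_negBinom_mul_alternating_sum α
      (fun l => poch (β - ε) (l + p.2) / poch β (l + p.2)) p.1
    rw [← Finset.Nat.sum_antidiagonal_swap (f := fun q => negBinom α q.1 * negBinom (-α) q.2 *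
      (poch (β - ε) (q.1 + p.2) / poch β (q.1 + p.2)))] at h
    simp only [sum_choose_mul_poch_div_poch ε β hβ, Prod.fst_swap, Prod.snd_swap] at h
    calc _ = negBinom (γ - α) p.2 * ∑ q ∈ antidiagonal p.1, (-1) ^ q.1 * negBinom α q.1 *
          negBinom q.1 q.2 * (poch ε q.1 * poch (β - ε) p.2 / poch β (q.1 + p.2)) := by
            rw [Finset.mul_sum]
            exact Finset.sum_congr rfl fun q _ => by ring
      _ = _ := by
        rw [h, Finset.mul_sum]
        exact Finset.sum_congr rfl fun q _ => by ring
  rw [Finset.sum_congr rfl h1, sum_antidiagonal_assoc (fun i l n => negBinom (-α) i *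
    (negBinom α l * negBinom (γ - α) n * (poch (β - ε) (l + n) / poch β (l + n))))]
  refine Finset.sum_congr rfl fun p _ => ?_
  rw [← Finset.mul_sum]
  congr 1
  have h2 := sum_negBinom_mul_negBinom α (γ - α) p.2
  rw [add_sub_cancel] at h2
  rw [← h2, mul_div_assoc, Finset.sum_mul]
  refine Finset.sum_congr rfl fun q hq => ?_
  rw [Finset.HasAntidiagonal.mem_antidiagonal] at hq
  rw [hq]

theorem poch_eq_eval (a : ℂ) (n : ℕ) : poch a n = (ascPochhammer ℂ n).eval a := by
  induction n with
  | zero => simp [poch_zero]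
  | succ n ih => rw [poch_succ, ih, ascPochhammer_succ_eval]

theorem negBinom_eq_choose (a : ℂ) (n : ℕ) : negBinom a n = Ring.choose (a + n - 1) n := by
  have h1 : (n.factorial : ℂ) ≠ 0 := by exact_mod_cast n.factorial_ne_zero
  have h := Ring.factorial_nsmul_multichoose_eq_ascPochhammer a n
  rw [Polynomial.ascPochhammer_smeval_eq_eval, ← poch_eq_eval, Ring.multichoose_eq,
    nsmul_eq_mul] at h
  rw [negBinom, ← h, mul_div_cancel_left₀ _ h1]

theorem tsum_negBinom_half (a : ℂ) : ∑' n, negBinom a n * (1 / 2) ^ n = (2 : ℂ) ^ a := by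
  have h := (Complex.one_div_one_sub_cpow_hasFPowerSeriesOnBall_zero a).hasSum
    (y := 1 / 2) (by
      rw [Metric.mem_eball, edist_zero_right, ← ofReal_norm, ENNReal.ofReal_lt_one]
      norm_num)
  have h2 : (1 : ℂ) / (1 - (0 + 1 / 2)) ^ a = 2 ^ a := by
    rw [show (1 : ℂ) - (0 + 1 / 2) = ((2 : ℝ) : ℂ)⁻¹ by norm_num,
      Complex.inv_cpow _ _ (by rw [Complex.arg_ofReal_of_nonneg (by norm_num)]
                               exact Real.pi_ne_zero.symm)]
    simp
  rw [h2] at h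
  rw [← h.tsum_eq]
  refine tsum_congr fun n => ?_
  simp [negBinom_eq_choose, mul_comm]

theorem summable_of_eventually_ratio {f : ℕ → ℂ} {ρ : ℕ → ℂ} {l : ℂ} (hl : ‖l‖ < 1)
    (hρ : Filter.Tendsto ρ Filter.atTop (nhds l))
    (h : ∀ᶠ n in Filter.atTop, f (n + 1) = ρ n * f n) : Summable fun n => ‖f n‖ := by
  obtain ⟨r, hr1, hr2⟩ := exists_between hl
  have h3 : ∀ᶠ n in Filter.atTop, ‖ρ n‖ < r := hρ.norm.eventually_lt_const hr1
  refine summable_of_ratio_norm_eventually_le hr2 ?_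
  filter_upwards [h, h3] with n h h3
  simp only [norm_norm, h, norm_mul]
  gcongr

theorem tendsto_add_div_add (a b : ℂ) : Filter.Tendsto (fun n : ℕ => (a + n) / (b + n))
    Filter.atTop (nhds 1) := by
  have h := tendsto_add_mul_div_add_mul_atTop_nhds a b (1 : ℂ) one_ne_zero
  simpa using h

/-- Terms of the regularised Gauss series `₂F₁(a, b; c; 1/2) / Γ(c)`. -/
def regTerm (a b c : ℂ) (n : ℕ) : ℂ := negBinom a n * poch b n * (Gamma (c + n))⁻¹ * (1 / 2) ^ n

theorem inv_Gamma_add_nat (c : ℂ) (n : ℕ) :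
    (Gamma (c + n))⁻¹ = (c + n) * (Gamma (c + 1 + n))⁻¹ := by
  rw [one_div_Gamma_eq_self_mul_one_div_Gamma_add_one, add_right_comm]

theorem eventually_add_nat_ne_zero (c : ℂ) : ∀ᶠ n : ℕ in Filter.atTop, c + n ≠ 0 := by
  filter_upwards [Filter.eventually_gt_atTop ⌈‖c‖⌉₊] with n hn h
  have h1 : ‖c‖ < n := Nat.lt_of_ceil_lt hn
  rw [eq_neg_of_add_eq_zero_left h] at h1
  simp at h1

theorem negBinom_succ (a : ℂ) (n : ℕ) :
    negBinom a (n + 1) = (a + n) / (1 + n) * negBinom a n := by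
  have h := succ_mul_negBinom_succ a n
  have h2 : (1 : ℂ) + n ≠ 0 := by rw [add_comm]; exact_mod_cast n.succ_ne_zero
  field_simp
  linear_combination h

theorem summable_regTerm (a b c : ℂ) : Summable fun n => ‖regTerm a b c n‖ := by
  have h := ((tendsto_add_div_add a 1).mul (tendsto_add_div_add b c)).mul_const (1 / 2 : ℂ)
  refine summable_of_eventually_ratio (by norm_num) h ?_
  filter_upwards [eventually_add_nat_ne_zero c] with n hn
  rw [regTerm, regTerm, negBinom_succ, poch_succ, inv_Gamma_add_nat c n, pow_succ]
  rw [show c + ((n + 1 : ℕ) : ℂ) = c + 1 + n by push_cast; ring]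
  field_simp

theorem summable_negBinom_half (a : ℂ) : Summable fun n => ‖negBinom a n * (1 / 2) ^ n‖ := by
  have h := (tendsto_add_div_add a 1).mul_const (1 / 2 : ℂ)
  refine summable_of_eventually_ratio (by norm_num) h ?_
  filter_upwards with n
  rw [negBinom_succ, pow_succ]
  ring

theorem Gamma_add_nat (c : ℂ) (hc : notNonposInt c) (n : ℕ) :
    Gamma (c + n) = poch c n * Gamma c := by
  induction n with
  | zero => simp [poch_zero]
  | succ n ih =>
    rw [Nat.cast_succ, ← add_assoc, Gamma_add_one _ fun h => hc n (eq_neg_of_add_eq_zero_left h),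
      ih, poch_succ]
    ring

theorem poch_ne_zero (c : ℂ) (hc : notNonposInt c) (n : ℕ) : poch c n ≠ 0 :=
  Finset.prod_ne_zero_iff.2 fun k _ h => hc k (eq_neg_of_add_eq_zero_left h)

theorem Gamma_mul_regTerm (a b c : ℂ) (hc : notNonposInt c) (n : ℕ) :
    Gamma c * regTerm a b c n = negBinom a n * poch b n / poch c n * (1 / 2) ^ n := by
  have h1 := Gamma_ne_zero hc
  have h2 := poch_ne_zero c hc n
  rw [regTerm, Gamma_add_nat c hc]
  field_simp

/-- Euler's transformation at `1/2`. -/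
theorem tsum_regTerm_euler (a b c : ℂ) (hc : notNonposInt c) :
    (∑' n, regTerm a b c n) * 2 ^ (c - a - b) = ∑' n, regTerm (c - a) (c - b) c n := by
  rw [← tsum_negBinom_half, tsum_mul_tsum_eq_tsum_sum_antidiagonal_of_summable_norm
    (summable_regTerm a b c) (summable_negBinom_half _)]
  refine tsum_congr fun n => ?_
  apply mul_left_cancel₀ (Gamma_ne_zero hc)
  rw [Gamma_mul_regTerm _ _ _ hc, ← sum_hypergeometric_mul_negBinom a b c (poch_ne_zero c hc),
    Finset.mul_sum, Finset.sum_mul]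
  refine Finset.sum_congr rfl fun p hp => ?_
  rw [Finset.HasAntidiagonal.mem_antidiagonal] at hp
  rw [← mul_assoc, Gamma_mul_regTerm _ _ _ hc, ← hp, pow_add]
  ring

theorem tsum_triple_antidiagonal {f : (ℕ × ℕ) × ℕ → ℂ} (hf : Summable f) :
    ∑' x, f x = ∑' N, ∑ p ∈ antidiagonal N, ∑ q ∈ antidiagonal p.1, f (q, p.2) := by
  let e : (Σ N : ℕ, Σ p : antidiagonal N, antidiagonal p.1.1) ≃ (ℕ × ℕ) × ℕ :=
    { toFun := fun x => (x.2.2.1, x.2.1.1.2)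
      invFun := fun x => ⟨x.1.1 + x.1.2 + x.2, ⟨(x.1.1 + x.1.2, x.2), by simp⟩, ⟨x.1, by simp⟩⟩
      left_inv := by
        rintro ⟨N, ⟨⟨a, b⟩, h⟩, ⟨⟨c, d⟩, h'⟩⟩
        rw [Finset.HasAntidiagonal.mem_antidiagonal] at h h'
        dsimp only at h h'
        subst h'
        subst h
        rfl
      right_inv := fun _ => rfl }
  have hs : Summable (f ∘ e) := e.summable_iff.2 hf
  refine (e.tsum_eq f).symm.trans ((hs.tsum_sigma' fun N => Summable.of_finite).trans ?_)
  refine tsum_congr fun N => ?_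
  rw [tsum_fintype, Fintype.sum_sigma, ← Finset.sum_coe_sort (antidiagonal N)]
  refine Finset.sum_congr rfl fun p _ => ?_
  rw [← Finset.sum_coe_sort (antidiagonal p.1.1)]
  rfl

theorem norm_negBinom_natCast (m k : ℕ) : (‖negBinom m k‖ : ℂ) = negBinom m k := by
  have h : negBinom m k = ((∏ i ∈ Finset.range k, ((m : ℝ) + i)) / (k.factorial : ℝ) : ℝ) := by
    simp [negBinom, poch]
  rw [h, Complex.norm_real, Real.norm_of_nonneg]
  positivity

theorem tsum_norm_negBinom_natCast_half (m : ℕ) :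
    ∑' k, ‖negBinom m k * (1 / 2) ^ k‖ = 2 ^ m := by
  have h := tsum_negBinom_half m
  apply Complex.ofReal_injective
  rw [Complex.ofReal_tsum]
  push_cast
  rw [← Complex.cpow_natCast, ← h]
  refine tsum_congr fun k => ?_
  rw [norm_mul, Complex.ofReal_mul, norm_negBinom_natCast]
  simp

theorem tsum_kdfTerm (α β γ ε : ℂ) (hβ : notNonposInt β)
    (hsum : Summable fun p : ℕ × ℕ => ‖kdfTerm α ε (β - ε) (γ - α) β (-1) (1 / 2) p‖) :
    ∑' p : ℕ × ℕ, kdfTerm α ε (β - ε) (γ - α) β (-1) (1 / 2) p =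
      2 ^ (-α) * (Gamma β * ∑' n, regTerm γ (β - ε) β n) := by
  set T := kdfTerm α ε (β - ε) (γ - α) β (-1) (1 / 2) with hT
  let f : (ℕ × ℕ) × ℕ → ℂ := fun x =>
    T x.1 * (1 / 2) ^ x.1.1 * (negBinom x.1.1 x.2 * (1 / 2) ^ x.2)
  have hpow : ∀ m : ℕ, (1 / 2 : ℂ) ^ m * 2 ^ m = 1 := fun m => by
    rw [← mul_pow]; norm_num
  have hf : Summable f := by
    apply Summable.of_norm
    rw [summable_prod_of_nonneg fun x => norm_nonneg _]
    constructor
    · intro p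
      simp only [f, norm_mul _ (_ * _)]
      exact (summable_negBinom_half _).mul_left _
    · refine hsum.congr fun p => ?_
      simp only [f, norm_mul _ (_ * _)]
      rw [tsum_mul_left, tsum_norm_negBinom_natCast_half, norm_mul, mul_assoc]
      have : ‖(1 / 2 : ℂ) ^ p.1‖ * 2 ^ p.1 = 1 := by
        rw [norm_pow, ← mul_pow]; norm_num
      rw [this, mul_one]
  have h1 : ∑' p, T p = ∑' x, f x := by
    rw [hf.tsum_prod' fun p => hf.prod_factor p]
    refine tsum_congr fun p => ?_
    simp only [f]
    rw [tsum_mul_left, tsum_negBinom_half, Complex.cpow_natCast, mul_assoc, hpow, mul_one]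
  let e : (ℕ × ℕ) × ℕ ≃ (ℕ × ℕ) × ℕ :=
    { toFun := fun x => ((x.1.1, x.2), x.1.2)
      invFun := fun x => ((x.1.1, x.2), x.1.2)
      left_inv := fun _ => rfl
      right_inv := fun _ => rfl }
  have hfe : Summable (f ∘ e) := e.summable_iff.2 hf
  rw [h1, ← e.tsum_eq, ← tsum_negBinom_half, ← tsum_mul_left]
  simp only [Gamma_mul_regTerm _ _ _ hβ]
  have hs : Summable fun n => ‖negBinom γ n * poch (β - ε) n / poch β n * (1 / 2) ^ n‖ := by
    refine ((summable_regTerm γ (β - ε) β).mul_left ‖Gamma β‖).congr fun n => ?_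
    rw [← norm_mul, Gamma_mul_regTerm _ _ _ hβ]
  rw [tsum_mul_tsum_eq_tsum_sum_antidiagonal_of_summable_norm (summable_negBinom_half _) hs]
  refine (tsum_triple_antidiagonal hfe).trans (tsum_congr fun N => ?_)
  have h2 := congrArg ((1 / 2 : ℂ) ^ N * ·)
    (sum_antidiagonal_kdf_coeff α β γ ε (poch_ne_zero β hβ) N)
  refine Eq.trans ?_ (h2.trans ?_)
  · rw [Finset.mul_sum]
    refine Finset.sum_congr rfl fun p hp => ?_
    rw [Finset.mul_sum]
    refine Finset.sum_congr rfl fun q hq => ?_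
    rw [Finset.HasAntidiagonal.mem_antidiagonal] at hp hq
    simp only [Function.comp, e, f, Equiv.coe_fn_mk, hT, kdfTerm, negBinom, ← hp, ← hq, pow_add]
    ring
  · rw [Finset.mul_sum]
    refine Finset.sum_congr rfl fun p hp => ?_
    rw [Finset.HasAntidiagonal.mem_antidiagonal] at hp
    rw [← hp, pow_add]
    ring

theorem regTerm_succ (a b c : ℂ) (n : ℕ) :
    2 * ((n : ℂ) + 1) * (c + n) * regTerm a b c (n + 1) = (a + n) * (b + n) * regTerm a b c n := by
  have h := succ_mul_negBinom_succ a n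
  rw [regTerm, regTerm, poch_succ, inv_Gamma_add_nat c n, pow_succ,
    show c + ((n + 1 : ℕ) : ℂ) = c + 1 + n by push_cast; ring]
  linear_combination (c + n) * poch b n * (b + n) * (Gamma (c + 1 + n))⁻¹ * (1 / 2) ^ n * h

theorem regTerm_eq_add_one (a b c : ℂ) (n : ℕ) :
    regTerm a b c n = (c + n) * regTerm a b (c + 1) n := by
  rw [regTerm, regTerm, inv_Gamma_add_nat c n]
  ring

theorem summable_nat_mul_regTerm (a b c : ℂ) : Summable fun n : ℕ => (n : ℂ) * regTerm a b c n := by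
  have h := ((tendsto_add_div_add 1 0).mul
    ((tendsto_add_div_add a 1).mul (tendsto_add_div_add b c))).mul_const (1 / 2 : ℂ)
  apply Summable.of_norm
  refine summable_of_eventually_ratio (by norm_num) h ?_
  filter_upwards [eventually_add_nat_ne_zero c, Filter.eventually_ne_atTop 0] with n hn hn0
  have h0 : (n : ℂ) ≠ 0 := by exact_mod_cast hn0
  have h1 : (n : ℂ) + 1 ≠ 0 := by exact_mod_cast n.succ_ne_zero
  have h2 := regTerm_succ a b c n
  push_cast
  rw [zero_add, add_comm 1 (n : ℂ)]
  field_simp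
  linear_combination h2

theorem tsum_regTerm_bailey_recurrence (ε c : ℂ) :
    ∑' n, regTerm (1 - ε) ε c n =
      (c + ε) * (c + 1 - ε) * ∑' n, regTerm (1 - ε) ε (c + 2) n := by
  set G : ℕ → ℂ := fun n => -2 * (n * regTerm (1 - ε) ε (c + 1) n) with hG
  have hGs : Summable G := (summable_nat_mul_regTerm _ _ _).mul_left _
  have hs := (summable_regTerm (1 - ε) ε (c + 2)).of_norm
  have h0 : ∑' n, G n = ∑' n, G (n + 1) := by
    rw [hGs.tsum_eq_zero_add]; simp [hG]
  have h1 : ∀ n, regTerm (1 - ε) ε c n =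
      (c + ε) * (c + 1 - ε) * regTerm (1 - ε) ε (c + 2) n + (G (n + 1) - G n) := by
    intro n
    have e2 := regTerm_succ (1 - ε) ε (c + 2) n
    simp only [hG, regTerm_eq_add_one _ _ c, regTerm_eq_add_one _ _ (c + 1)]
    rw [show c + 1 + 1 = c + 2 by ring]
    push_cast
    linear_combination e2
  have hGs' : Summable fun n => G (n + 1) := (summable_nat_add_iff 1).2 hGs
  rw [tsum_congr h1, (hs.mul_left _).tsum_add (hGs'.sub hGs), hGs'.tsum_sub hGs, ← h0, sub_self,
    add_zero, tsum_mul_left]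

/-- The closed form in Bailey's theorem, divided by `Γ(c)`. -/
def baileyValue (ε c : ℂ) : ℂ :=
  2 ^ (1 - c) * (√Real.pi : ℂ) * (Gamma ((c + ε) / 2))⁻¹ * (Gamma ((c + 1 - ε) / 2))⁻¹

theorem baileyValue_recurrence (ε c : ℂ) :
    baileyValue ε c = (c + ε) * (c + 1 - ε) * baileyValue ε (c + 2) := by
  rw [baileyValue, baileyValue, one_div_Gamma_eq_self_mul_one_div_Gamma_add_one ((c + ε) / 2),
    one_div_Gamma_eq_self_mul_one_div_Gamma_add_one ((c + 1 - ε) / 2),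
    show (c + 2 + ε) / 2 = (c + ε) / 2 + 1 by ring,
    show (c + 2 + 1 - ε) / 2 = (c + 1 - ε) / 2 + 1 by ring,
    show 1 - c = 1 - (c + 2) + (2 : ℕ) by push_cast; ring,
    Complex.cpow_add _ _ two_ne_zero, Complex.cpow_natCast]
  ring

theorem exists_bailey_shift (ε c : ℂ) (k : ℕ) : ∃ P : ℂ,
    ∑' n, regTerm (1 - ε) ε c n = P * ∑' n, regTerm (1 - ε) ε (c + 2 * k) n ∧
    baileyValue ε c = P * baileyValue ε (c + 2 * k) := by
  induction k with
  | zero => exact ⟨1, by simp⟩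
  | succ k ih =>
    obtain ⟨P, h1, h2⟩ := ih
    refine ⟨P * ((c + 2 * k + ε) * (c + 2 * k + 1 - ε)), ?_, ?_⟩
    · rw [h1, tsum_regTerm_bailey_recurrence, Nat.cast_succ, mul_add, mul_one, ← add_assoc]
      ring
    · rw [h2, baileyValue_recurrence, Nat.cast_succ, mul_add, mul_one, ← add_assoc]
      ring

theorem notNonposInt_of_re_pos {c : ℂ} (hc : 0 < c.re) : notNonposInt c := by
  rintro n rfl
  simp at hc
  exact absurd hc (not_lt.2 n.cast_nonneg)

theorem tendsto_pow_mul_factorial_div_Gamma {s : ℂ} (hs : 0 < s.re) :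
    Filter.Tendsto (fun n : ℕ => (n : ℂ) ^ s * n.factorial / Gamma (s + (n + 1 : ℕ)))
      Filter.atTop (nhds 1) := by
  have hs' := notNonposInt_of_re_pos hs
  have h0 := Gamma_ne_zero hs'
  have h := (GammaSeq_tendsto_Gamma s).div_const (Gamma s)
  rw [div_self h0] at h
  refine h.congr fun n => ?_
  rw [Gamma_add_nat s hs', GammaSeq, poch, div_div]

theorem tendsto_Gamma_mul_baileyValue {ε c : ℂ} (hc : ‖ε‖ < c.re) :
    Filter.Tendsto (fun k : ℕ => Gamma (c + 2 * (k + 1 : ℕ)) * baileyValue ε (c + 2 * (k + 1 : ℕ)))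
      Filter.atTop (nhds 1) := by
  have hε := (abs_le.1 (Complex.abs_re_le_norm ε))
  have hε0 := norm_nonneg ε
  have e1 : 0 < (c / 2).re := by simp; linarith
  have e2 : 0 < (c / 2 + 1 / 2).re := by simp; linarith
  have e3 : 0 < ((c + ε) / 2).re := by simp; linarith
  have e4 : 0 < ((c + 1 - ε) / 2).re := by simp; linarith
  have h := ((tendsto_pow_mul_factorial_div_Gamma e3).mul
    (tendsto_pow_mul_factorial_div_Gamma e4)).div ((tendsto_pow_mul_factorial_div_Gamma e1).mul
    (tendsto_pow_mul_factorial_div_Gamma e2)) (by simp)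
  rw [mul_one, div_one] at h
  refine h.congr' ?_
  filter_upwards [Filter.eventually_ne_atTop 0] with k hk
  have hk0 : (k : ℂ) ≠ 0 := by exact_mod_cast hk
  have hf : (k.factorial : ℂ) ≠ 0 := by exact_mod_cast k.factorial_ne_zero
  have hpow : (k : ℂ) ^ ((c + ε) / 2) * (k : ℂ) ^ ((c + 1 - ε) / 2) =
      (k : ℂ) ^ (c / 2) * (k : ℂ) ^ (c / 2 + 1 / 2) := by
    rw [← Complex.cpow_add _ _ hk0, ← Complex.cpow_add _ _ hk0]
    congr 1
    ring
  have hp1 : (k : ℂ) ^ (c / 2) ≠ 0 := by simp [Complex.cpow_eq_zero_iff, hk0]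
  have hp2 : (k : ℂ) ^ (c / 2 + 1 / 2) ≠ 0 := by simp [Complex.cpow_eq_zero_iff, hk0]
  have hG : ∀ {s : ℂ}, 0 < s.re → Gamma (s + (k + 1 : ℕ)) ≠ 0 := fun hs =>
    Complex.Gamma_ne_zero_of_re_pos (by rw [Complex.add_re, Complex.natCast_re]; positivity)
  have g1 := hG e1
  have g2 := hG e2
  have g3 := hG e3
  have g4 := hG e4
  have hdup := Complex.Gamma_mul_Gamma_add_half (c / 2 + (k + 1 : ℕ))
  rw [show c / 2 + ((k + 1 : ℕ) : ℂ) + 1 / 2 = c / 2 + 1 / 2 + ((k + 1 : ℕ) : ℂ) by ring,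
    show 2 * (c / 2 + ((k + 1 : ℕ) : ℂ)) = c + 2 * ((k + 1 : ℕ) : ℂ) by ring] at hdup
  rw [baileyValue, show (c + 2 * ((k + 1 : ℕ) : ℂ) + ε) / 2 = (c + ε) / 2 + ((k + 1 : ℕ) : ℂ) by ring,
    show (c + 2 * ((k + 1 : ℕ) : ℂ) + 1 - ε) / 2 = (c + 1 - ε) / 2 + ((k + 1 : ℕ) : ℂ) by ring]
  simp only [Pi.div_apply]
  calc _ = ((k : ℂ) ^ ((c + ε) / 2) * (k : ℂ) ^ ((c + 1 - ε) / 2)) /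
        ((k : ℂ) ^ (c / 2) * (k : ℂ) ^ (c / 2 + 1 / 2)) *
        (Gamma (c / 2 + (k + 1 : ℕ)) * Gamma (c / 2 + 1 / 2 + (k + 1 : ℕ))) *
        (Gamma ((c + ε) / 2 + (k + 1 : ℕ)))⁻¹ * (Gamma ((c + 1 - ε) / 2 + (k + 1 : ℕ)))⁻¹ := by
          field_simp
    _ = _ := by
      rw [hpow, div_self (mul_ne_zero hp1 hp2), hdup]
      ring

theorem norm_poch_one_le {c : ℂ} (hc : 1 ≤ c.re) (n : ℕ) : ‖poch 1 n‖ ≤ ‖poch c n‖ := by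
  simp only [poch, norm_prod]
  refine Finset.prod_le_prod (fun _ _ => norm_nonneg _) fun k _ => ?_
  have h1 : ‖(1 : ℂ) + k‖ = 1 + k := by
    rw [← Nat.cast_one, ← Nat.cast_add, Complex.norm_natCast]; push_cast; rfl
  rw [h1]
  refine le_trans ?_ (Complex.re_le_norm _)
  simpa using hc

theorem tendsto_Gamma_mul_tsum_regTerm (a b : ℂ) {c : ℂ} (hc : 0 < c.re) :
    Filter.Tendsto
      (fun k : ℕ => Gamma (c + 2 * (k + 1 : ℕ)) * ∑' n, regTerm a b (c + 2 * (k + 1 : ℕ)) n)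
      Filter.atTop (nhds 1) := by
  have hre : ∀ k : ℕ, 1 ≤ (c + 2 * (k + 1 : ℕ)).re := by
    intro k
    have : (0 : ℝ) ≤ k := k.cast_nonneg
    simp
    linarith
  have hne : ∀ k : ℕ, notNonposInt (c + 2 * (k + 1 : ℕ)) := fun k =>
    notNonposInt_of_re_pos (lt_of_lt_of_le one_pos (hre k))
  have hone : notNonposInt 1 := notNonposInt_of_re_pos (by simp)
  simp only [← tsum_mul_left, Gamma_mul_regTerm _ _ _ (hne _)]
  have hlim : ∑' n, negBinom a n * poch b n * 0 ^ n * (1 / 2) ^ n = 1 := by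
    rw [tsum_eq_single 0 fun n hn => by simp [hn]]
    simp [negBinom_zero, poch_zero]
  have hnhds := congrArg nhds hlim
  rw [← hnhds]
  refine tendsto_tsum_of_dominated_convergence
    ((summable_regTerm a b 1).mul_left ‖Gamma 1‖) ?_ ?_
  · intro n
    have hinv : Filter.Tendsto (fun k : ℕ => (poch (c + 2 * (k + 1 : ℕ)) n)⁻¹)
        Filter.atTop (nhds (0 ^ n)) := by
      have h1 : ∀ j ∈ Finset.range n, Filter.Tendsto
          (fun k : ℕ => (c + 2 * (k + 1 : ℕ) + j)⁻¹) Filter.atTop (nhds 0) := by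
        intro j _
        refine Filter.tendsto_inv₀_cobounded.comp ?_
        rw [← tendsto_norm_atTop_iff_cobounded]
        refine Filter.tendsto_atTop_mono (fun k : ℕ => ?_) tendsto_natCast_atTop_atTop
        refine le_trans ?_ (Complex.re_le_norm _)
        have : (0 : ℝ) ≤ k := k.cast_nonneg
        have : (0 : ℝ) ≤ j := j.cast_nonneg
        simp
        linarith
      have h2 := tendsto_finsetProd _ h1
      simpa [poch, Finset.prod_inv_distrib] using h2
    simp only [div_eq_mul_inv _ (poch _ _)]
    exact (hinv.const_mul _).mul_const _
  · filter_upwards with k n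
    rw [← norm_mul, Gamma_mul_regTerm _ _ _ hone, norm_mul, norm_mul, norm_div, norm_div]
    have h1 := norm_poch_one_le (hre k) n
    have h2 : 0 < ‖poch 1 n‖ := norm_pos_iff.2 (poch_ne_zero 1 hone n)
    gcongr

/-- Bailey's summation theorem, divided by `Γ(c)`. -/
theorem tsum_regTerm_bailey (ε c : ℂ) : ∑' n, regTerm (1 - ε) ε c n = baileyValue ε c := by
  have key : ∀ c : ℂ, ‖ε‖ < c.re → ∑' n, regTerm (1 - ε) ε c n = baileyValue ε c := by
    intro c hc
    have h1 := (tendsto_Gamma_mul_baileyValue hc).const_mul (∑' n, regTerm (1 - ε) ε c n)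
    have h2 := (tendsto_Gamma_mul_tsum_regTerm (1 - ε) ε
      (lt_of_le_of_lt (norm_nonneg ε) hc)).const_mul (baileyValue ε c)
    rw [mul_one] at h1 h2
    refine tendsto_nhds_unique (h1.congr fun k => ?_) h2
    obtain ⟨P, hR, hD⟩ := exists_bailey_shift ε c (k + 1)
    rw [hR, hD]
    ring
  obtain ⟨k, hk⟩ := exists_nat_gt (‖ε‖ - c.re)
  obtain ⟨P, hR, hD⟩ := exists_bailey_shift ε c k
  rw [hR, hD, key]
  have : (0 : ℝ) ≤ k := k.cast_nonneg
  simp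
  linarith

theorem mul_negBinom_add_one (a : ℂ) (n : ℕ) : a * negBinom (a + 1) n = (a + n) * negBinom a n := by
  have h : a * poch (a + 1) n = poch a n * (a + n) := by
    rw [← poch_succ, add_comm n, poch_add]
    simp [poch]
  rw [negBinom, negBinom, ← mul_div_assoc, h]
  ring

theorem tsum_regTerm_contiguous (a b c : ℂ) :
    a * ∑' n, regTerm (a + 1) b (c + 1) n =
      ∑' n, regTerm a b c n - (c - a) * ∑' n, regTerm a b (c + 1) n := by
  rw [← tsum_mul_left, ← tsum_mul_left, ← (summable_regTerm a b c).of_norm.tsum_sub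
    ((summable_regTerm a b (c + 1)).of_norm.mul_left _)]
  refine tsum_congr fun n => ?_
  rw [regTerm_eq_add_one a b c, regTerm, regTerm]
  linear_combination poch b n * (Gamma (c + 1 + n))⁻¹ * (1 / 2) ^ n * mul_negBinom_add_one a n

/-- Generalised Bailey–Kummer summation. -/
theorem tsum_regTerm_eq_alternating_sum (ε : ℂ) (i : ℕ) (a : ℂ) (ha : notNonposInt a) :
    2 ^ (1 - ε) * poch (1 - ε) i * Gamma a * ∑' n, regTerm (1 - ε + i) ε (a - ε + i + 1) n =
      ∑ r ∈ Finset.range (i + 1), (-1 : ℂ) ^ r * (i.choose r : ℂ) *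
        (Gamma ((a + r) / 2) / Gamma ((a + r) / 2 + 1 - ε)) := by
  induction i generalizing a with
  | zero =>
    have h2 : Gamma ((a + 1) / 2) ≠ 0 := by
      refine Gamma_ne_zero fun n h => ha (2 * n + 1) ?_
      push_cast
      linear_combination 2 * h
    have hdup := Complex.Gamma_mul_Gamma_add_half (a / 2)
    rw [show a / 2 + 1 / 2 = (a + 1) / 2 by ring, show 2 * (a / 2) = a by ring] at hdup
    have hpow : (2 : ℂ) ^ (1 - ε) * 2 ^ (1 - (a - ε + 1)) = 2 ^ (1 - a) := by
      rw [← Complex.cpow_add _ _ two_ne_zero]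
      congr 1
      ring
    simp only [Nat.cast_zero, add_zero, poch_zero, zero_add, Finset.sum_range_one, pow_zero,
      Nat.choose_self, Nat.cast_one, mul_one, one_mul, tsum_regTerm_bailey, baileyValue]
    rw [show (a - ε + 1 + ε) / 2 = (a + 1) / 2 by ring,
      show (a - ε + 1 + 1 - ε) / 2 = a / 2 + 1 - ε by ring, div_eq_mul_inv (Gamma (a / 2)),
      (eq_mul_inv_iff_mul_eq₀ h2).2 hdup, ← hpow]
    ring
  | succ i ih =>
    have ha1 : notNonposInt (a + 1) := fun n h => ha (n + 1) (by
      push_cast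
      linear_combination h)
    have ha0 : a ≠ 0 := by simpa using ha 0
    have e1 := ih a ha
    have e2 := ih (a + 1) ha1
    have e3 := tsum_regTerm_contiguous (1 - ε + i) ε (a - ε + i + 1)
    rw [sum_alternating_choose_succ (fun r : ℕ => Gamma ((a + r) / 2) / Gamma ((a + r) / 2 + 1 - ε)),
      ← e1]
    have e4 : ∀ r : ℕ, a + ((r + 1 : ℕ) : ℂ) = a + 1 + r := fun r => by push_cast; ring
    simp only [e4]
    rw [← e2, poch_succ, Gamma_add_one a ha0]
    push_cast
    rw [show a + 1 - ε + i + 1 = a - ε + i + 1 + 1 by ring,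
      show a - ε + ((i : ℂ) + 1) + 1 = a - ε + i + 1 + 1 by ring,
      show 1 - ε + ((i : ℂ) + 1) = 1 - ε + i + 1 by ring]
    linear_combination 2 ^ (1 - ε) * poch (1 - ε) i * Gamma a * e3

theorem stmt_12 (i : ℕ) (α β ε : ℂ)
    (hβ : ∀ m n : ℕ, poch β (m + n) ≠ 0)
    (hΓ1 : notNonposInt (1 - ε))
    (hΓ2 : notNonposInt (β))
    (hΓ3 : notNonposInt (1 - ε + (i : ℂ)))
    (hΓ4 : notNonposInt (β + ε - (i : ℂ) - 1))
    (hΓs : ∀ r : ℕ, r ≤ i →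
      notNonposInt ((β + ε - (i : ℂ) + (r : ℂ) - 1) / 2) ∧ notNonposInt ((β - ε - (i : ℂ) + (r : ℂ) + 1) / 2))
    (hsum : Summable fun p : ℕ × ℕ => ‖kdfTerm α ε (β - ε) (β + ε - α - (i : ℂ) - 1) β (-1) (1/2) p‖) :
    (∑' p : ℕ × ℕ, kdfTerm α ε (β - ε) (β + ε - α - (i : ℂ) - 1) β (-1) (1/2) p) =
      (2 : ℂ) ^ (β + ε - α - (i : ℂ) - 2) * Gamma (1 - ε) * Gamma β /
        (Gamma (1 - ε + (i : ℂ)) * Gamma (β + ε - (i : ℂ) - 1)) *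
      ∑ r ∈ Finset.range (i + 1), (-1 : ℂ) ^ r * (i.choose r : ℂ) *
        Gamma ((β + ε - (i : ℂ) + (r : ℂ) - 1) / 2) /
        Gamma ((β - ε - (i : ℂ) + (r : ℂ) + 1) / 2) := by
  obtain ⟨γ, hγ⟩ : ∃ γ, γ = β + ε - (i : ℂ) - 1 := ⟨_, rfl⟩
  rw [← hγ] at hΓ4 ⊢
  rw [show β + ε - α - (i : ℂ) - 1 = γ - α by rw [hγ]; ring] at hsum ⊢
  have hS : ∑ r ∈ Finset.range (i + 1), (-1 : ℂ) ^ r * (i.choose r : ℂ) *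
        Gamma ((β + ε - (i : ℂ) + (r : ℂ) - 1) / 2) /
        Gamma ((β - ε - (i : ℂ) + (r : ℂ) + 1) / 2) =
      ∑ r ∈ Finset.range (i + 1), (-1 : ℂ) ^ r * (i.choose r : ℂ) *
        (Gamma ((γ + r) / 2) / Gamma ((γ + r) / 2 + 1 - ε)) := by
    refine Finset.sum_congr rfl fun r _ => ?_
    rw [hγ, ← mul_div_assoc]
    congr 3 <;> ring
  have hE := tsum_regTerm_euler γ (β - ε) β hΓ2
  rw [show β - γ = 1 - ε + i by rw [hγ]; ring, sub_sub_cancel] at hE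
  have h1 := Gamma_ne_zero hΓ1
  have h2 := Gamma_ne_zero hΓ4
  have h3 := poch_ne_zero _ hΓ1 i
  rw [hS, ← tsum_regTerm_eq_alternating_sum ε i γ hΓ4, tsum_kdfTerm α β γ ε hΓ2 hsum,
    Gamma_add_nat _ hΓ1, show γ - ε + i + 1 = β by rw [hγ]; ring, ← hE]
  have hpow : (2 : ℂ) ^ (-α) =
      2 ^ (β + ε - α - (i : ℂ) - 2) * 2 ^ (1 - ε) * 2 ^ (1 - ε + i - (β - ε)) := by
    rw [← Complex.cpow_add _ _ two_ne_zero, ← Complex.cpow_add _ _ two_ne_zero]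
    congr 1
    ring
  rw [hpow]
  field_simp
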